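/- arXiv:2202.09651 — 10 statements merged into one kernel-verified Lean document; each statement's English description precedes it below -/
import Mathlib

section
/- Suppose Assumption 1 holds. Then f is coercive, i.e., f(x) → ∞ as ‖x‖ → ∞, and consequently for every real t the level set L(t) = {x ∈ ℝᵖ : f(x) ≤ t} is compact. -/
open scoped RealInnerProductSpace

theorem half_sum_sq_sub_sum_sq_le {ι : Type*} (s : Finset ι) (q b : ι → ℝ) :
    (∑ i ∈ s, q i ^ 2) / 2 - ∑ i ∈ s, b i ^ 2 ≤ ∑ i ∈ s, (q i - b i) ^ 2 := by
  rw [Finset.sum_div, ← Finset.sum_sub_distrib]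
  refine Finset.sum_le_sum fun i _ => ?_
  nlinarith [sq_nonneg (q i - 2 * b i)]

/-- Under Assumption 1, the least-squares objective
`f(x) = (1/(4n)) ∑ᵢ (⟨x, Aᵢ x⟩ − bᵢ)²` is coercive (`f(x) → ∞` as `‖x‖ → ∞`),
and every level set `L(t) = {x : f x ≤ t}` is compact. -/
theorem stmt_0 {n p : ℕ} (hn : 0 < n) (hp : 0 < p)
    (A : Fin n → Matrix (Fin p) (Fin p) ℝ) (hA : ∀ i, (A i).IsSymm)
    (b : Fin n → ℝ) (lam lamBar : ℝ) (hlam : 0 < lam) (hlam' : lam ≤ lamBar)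
    (hAss : ∀ u v : EuclideanSpace ℝ (Fin p),
      lam * ‖u‖ ^ 2 * ‖v‖ ^ 2 ≤
          (1 / n : ℝ) * ∑ i, ⟪u, (Matrix.toEuclideanCLM (𝕜 := ℝ) (A i)) v⟫ ^ 2 ∧
        (1 / n : ℝ) * ∑ i, ⟪u, (Matrix.toEuclideanCLM (𝕜 := ℝ) (A i)) v⟫ ^ 2 ≤
          lamBar * ‖u‖ ^ 2 * ‖v‖ ^ 2)
    (f : EuclideanSpace ℝ (Fin p) → ℝ)
    (hf : ∀ x, f x = (1 / (4 * n) : ℝ) *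
      ∑ i, (⟪x, (Matrix.toEuclideanCLM (𝕜 := ℝ) (A i)) x⟫ - b i) ^ 2) :
    Filter.Tendsto f (Bornology.cobounded (EuclideanSpace ℝ (Fin p))) Filter.atTop ∧
      ∀ t : ℝ, IsCompact {x : EuclideanSpace ℝ (Fin p) | f x ≤ t} := by
  have hlower : ∀ x, lam / 8 * ‖x‖ ^ 4 - (1 / (4 * n) : ℝ) * ∑ i, b i ^ 2 ≤ f x := by
    intro x
    have hsq := mul_le_mul_of_nonneg_left
      (half_sum_sq_sub_sum_sq_le Finset.univ
        (fun i => ⟪x, (Matrix.toEuclideanCLM (𝕜 := ℝ) (A i)) x⟫) b)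
      (show (0 : ℝ) ≤ 1 / (4 * n) by positivity)
    have hquartic := (hAss x x).1
    rw [hf]
    refine le_trans ?_ hsq
    have hscale : (1 / (4 * n) : ℝ) = (1 / n) / 4 := by
      field_simp
    rw [hscale]
    linear_combination hquartic / 8
  have hcont : Continuous f := by
    rw [funext hf]
    fun_prop
  have htend : Filter.Tendsto f (Bornology.cobounded (EuclideanSpace ℝ (Fin p)))
      Filter.atTop := by
    refine Filter.tendsto_atTop_mono hlower (Filter.tendsto_atTop_add_const_right _ _ ?_)
    exact ((Filter.tendsto_pow_atTop (by norm_num)).comp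
      tendsto_norm_cobounded_atTop).const_mul_atTop (by positivity)
  refine ⟨htend, fun t => Metric.isCompact_of_isClosed_isBounded
    (isClosed_le hcont continuous_const) ?_⟩
  rw [← Bornology.isCobounded_compl_iff, Bornology.isCobounded_def]
  filter_upwards [htend.eventually_gt_atTop t] with x hx
  simpa using hx
end

section
/- Suppose Assumption 1 holds. Then for every x ∈ ℝᵖ, the gradient of f satisfies ‖∇f(x)‖ ≤ 2 √(λ̄ f(x)) · ‖x‖. -/
open scoped RealInnerProductSpace

/-- If the frame operator of `v` is bounded above by `C`, then so is the squared norm of the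
synthesis operator. -/
theorem norm_sq_sum_smul_le {ι E : Type*} [Fintype ι] [NormedAddCommGroup E]
    [InnerProductSpace ℝ E] (r : ι → ℝ) (v : ι → E) {C : ℝ} (hC₀ : 0 ≤ C)
    (hC : ∀ u : E, ∑ i, ⟪u, v i⟫ ^ 2 ≤ C * ‖u‖ ^ 2) :
    ‖∑ i, r i • v i‖ ^ 2 ≤ C * ∑ i, r i ^ 2 := by
  set w := ∑ i, r i • v i with hw
  have hinner : ‖w‖ ^ 2 = ∑ i, r i * ⟪w, v i⟫ := by
    rw [← real_inner_self_eq_norm_sq]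
    conv_lhs => rw [hw, inner_sum, ← hw]
    simp only [real_inner_smul_right]
  rcases eq_or_ne w 0 with h0 | h0
  · rw [h0, norm_zero, zero_pow two_ne_zero]
    exact mul_nonneg hC₀ (Finset.sum_nonneg fun i _ => sq_nonneg _)
  · have hpos : 0 < ‖w‖ ^ 2 := by positivity
    have hcs := Finset.sum_mul_sq_le_sq_mul_sq Finset.univ r fun i => ⟪w, v i⟫
    rw [← hinner] at hcs
    have hmul := mul_le_mul_of_nonneg_left (hC w)
      (Finset.sum_nonneg fun i (_ : i ∈ Finset.univ) => sq_nonneg (r i))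
    exact le_of_mul_le_mul_right (by linarith) hpos

/-- Under Assumption 1, the gradient
`∇f(x) = (1/n) ∑ᵢ (⟨x, Aᵢ x⟩ − bᵢ) Aᵢ x` of the least-squares objective satisfies
`‖∇f(x)‖ ≤ 2 √(λ̄ f(x)) ‖x‖`. -/
theorem stmt_1 {n p : ℕ} (hn : 0 < n) (hp : 0 < p)
    (A : Fin n → Matrix (Fin p) (Fin p) ℝ) (hA : ∀ i, (A i).IsSymm)
    (b : Fin n → ℝ) (lam lamBar : ℝ) (hlam : 0 < lam) (hlam' : lam ≤ lamBar)
    (hAss : ∀ u v : EuclideanSpace ℝ (Fin p),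
      lam * ‖u‖ ^ 2 * ‖v‖ ^ 2 ≤
          (1 / n : ℝ) * ∑ i, ⟪u, (Matrix.toEuclideanCLM (𝕜 := ℝ) (A i)) v⟫ ^ 2 ∧
        (1 / n : ℝ) * ∑ i, ⟪u, (Matrix.toEuclideanCLM (𝕜 := ℝ) (A i)) v⟫ ^ 2 ≤
          lamBar * ‖u‖ ^ 2 * ‖v‖ ^ 2)
    (f : EuclideanSpace ℝ (Fin p) → ℝ)
    (hf : ∀ x, f x = (1 / (4 * n) : ℝ) *
      ∑ i, (⟪x, (Matrix.toEuclideanCLM (𝕜 := ℝ) (A i)) x⟫ - b i) ^ 2)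
    (g : EuclideanSpace ℝ (Fin p) → EuclideanSpace ℝ (Fin p))
    (hg : ∀ x, g x = (1 / n : ℝ) •
      ∑ i, (⟪x, (Matrix.toEuclideanCLM (𝕜 := ℝ) (A i)) x⟫ - b i) •
        (Matrix.toEuclideanCLM (𝕜 := ℝ) (A i)) x) :
    ∀ x : EuclideanSpace ℝ (Fin p), ‖g x‖ ≤ 2 * Real.sqrt (lamBar * f x) * ‖x‖ := by
  intro x
  have hn' : (0 : ℝ) < n := Nat.cast_pos.mpr hn
  have hlamBar : 0 ≤ lamBar := hlam.le.trans hlam'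
  have hsum := norm_sq_sum_smul_le
    (fun i => ⟪x, (Matrix.toEuclideanCLM (𝕜 := ℝ) (A i)) x⟫ - b i)
    (fun i => (Matrix.toEuclideanCLM (𝕜 := ℝ) (A i)) x)
    (C := n * (lamBar * ‖x‖ ^ 2)) (by positivity) fun u => by
      have h := (hAss u x).2
      rw [one_div, inv_mul_le_iff₀ hn'] at h
      exact h.trans_eq (by ring)
  have hf_nonneg : 0 ≤ f x := by
    rw [hf]
    positivity
  refine (sq_le_sq₀ (norm_nonneg _) (by positivity)).mp ?_
  rw [mul_pow, mul_pow, Real.sq_sqrt (mul_nonneg hlamBar hf_nonneg), hg, norm_smul, mul_pow,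
    Real.norm_eq_abs, sq_abs]
  refine (mul_le_mul_of_nonneg_left hsum (sq_nonneg _)).trans_eq ?_
  rw [hf]
  field_simp
  ring
end

section
/- Suppose Assumption 1 holds. Then for every x ∈ ℝᵖ, the Hessian of f satisfies the spectral-norm bound ‖∇²f(x)‖ ≤ 2 λ̄ ‖x‖² + 2 √(λ̄ f(x)). -/
open scoped RealInnerProductSpace

/-- Cauchy–Schwarz for averages, with bounds on the mean squares. -/
theorem mul_sum_mul_le_of_mul_sum_sq_le {ι : Type*} [Fintype ι] {c s t : ℝ} (hc : 0 ≤ c)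
    (hs : 0 ≤ s) (ht : 0 ≤ t) (α β : ι → ℝ) (hα : c * ∑ i, α i ^ 2 ≤ s ^ 2)
    (hβ : c * ∑ i, β i ^ 2 ≤ t ^ 2) : c * ∑ i, α i * β i ≤ s * t := by
  refine le_of_sq_le_sq ?_ (mul_nonneg hs ht)
  calc (c * ∑ i, α i * β i) ^ 2 = c ^ 2 * (∑ i, α i * β i) ^ 2 := mul_pow _ _ _
    _ ≤ c ^ 2 * ((∑ i, α i ^ 2) * ∑ i, β i ^ 2) := by
        gcongr
        exact Finset.sum_mul_sq_le_sq_mul_sq _ _ _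
    _ = (c * ∑ i, α i ^ 2) * (c * ∑ i, β i ^ 2) := by ring
    _ ≤ s ^ 2 * t ^ 2 := by
        refine mul_le_mul hα hβ ?_ (sq_nonneg s)
        exact mul_nonneg hc (Finset.sum_nonneg fun i _ => sq_nonneg _)
    _ = (s * t) ^ 2 := (mul_pow _ _ _).symm

/-- An upper bound on the bilinear form of an operator bounds its norm. -/
theorem ContinuousLinearMap.opNorm_le_of_inner_le {E : Type*} [NormedAddCommGroup E]
    [InnerProductSpace ℝ E] (T : E →L[ℝ] E) {C : ℝ} (hC : 0 ≤ C)
    (h : ∀ u v, ⟪u, T v⟫ ≤ C * ‖u‖ * ‖v‖) : ‖T‖ ≤ C := by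
  refine T.opNorm_le_bound hC fun v => ?_
  rcases (norm_nonneg (T v)).eq_or_lt with h0 | h0
  · rw [← h0]
    positivity
  · have hv := h (T v) v
    rw [real_inner_self_eq_norm_sq] at hv
    refine le_of_mul_le_mul_left ?_ h0
    linarith

/-- The bilinear form of `B * (x xᵀ) * B` factors through `x`. -/
theorem inner_toEuclideanCLM_mul_vecMulVec_mul {m : Type*} [Fintype m] [DecidableEq m]
    (B : Matrix m m ℝ) (x u v : EuclideanSpace ℝ m) :
    ⟪u, Matrix.toEuclideanCLM (𝕜 := ℝ)
        (B * Matrix.vecMulVec (x : m → ℝ) (x : m → ℝ) * B) v⟫ =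
      ⟪u, Matrix.toEuclideanCLM (𝕜 := ℝ) B x⟫ * ⟪x, Matrix.toEuclideanCLM (𝕜 := ℝ) B v⟫ := by
  have hx (w : EuclideanSpace ℝ m) : Matrix.toEuclideanCLM (𝕜 := ℝ)
      (Matrix.vecMulVec (x : m → ℝ) (x : m → ℝ)) w = ⟪x, w⟫ • x := by
    ext j
    simp [Matrix.vecMulVec_mulVec, PiLp.inner_apply, dotProduct, mul_comm]
  rw [map_mul, map_mul, mul_apply_eq_comp, mul_apply_eq_comp, hx,
    map_smul, inner_smul_right, mul_comm]

/-- Under Assumption 1, the Hessian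
`∇²f(x) = (2/n) ∑ᵢ Aᵢ x xᵀ Aᵢ + (1/n) ∑ᵢ (⟨x, Aᵢ x⟩ − bᵢ) Aᵢ` satisfies the spectral
norm bound `‖∇²f(x)‖ ≤ 2 λ̄ ‖x‖² + 2 √(λ̄ f(x))`. -/
theorem stmt_2 {n p : ℕ} (hn : 0 < n) (hp : 0 < p)
    (A : Fin n → Matrix (Fin p) (Fin p) ℝ) (hA : ∀ i, (A i).IsSymm)
    (b : Fin n → ℝ) (lam lamBar : ℝ) (hlam : 0 < lam) (hlam' : lam ≤ lamBar)
    (hAss : ∀ u v : EuclideanSpace ℝ (Fin p),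
      lam * ‖u‖ ^ 2 * ‖v‖ ^ 2 ≤
          (1 / n : ℝ) * ∑ i, ⟪u, (Matrix.toEuclideanCLM (𝕜 := ℝ) (A i)) v⟫ ^ 2 ∧
        (1 / n : ℝ) * ∑ i, ⟪u, (Matrix.toEuclideanCLM (𝕜 := ℝ) (A i)) v⟫ ^ 2 ≤
          lamBar * ‖u‖ ^ 2 * ‖v‖ ^ 2)
    (f : EuclideanSpace ℝ (Fin p) → ℝ)
    (hf : ∀ x, f x = (1 / (4 * n) : ℝ) *
      ∑ i, (⟪x, (Matrix.toEuclideanCLM (𝕜 := ℝ) (A i)) x⟫ - b i) ^ 2)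
    (H : EuclideanSpace ℝ (Fin p) → Matrix (Fin p) (Fin p) ℝ)
    (hH : ∀ x, H x =
      (2 / n : ℝ) • ∑ i, A i * Matrix.vecMulVec (x : Fin p → ℝ) (x : Fin p → ℝ) * A i +
      (1 / n : ℝ) • ∑ i, (⟪x, (Matrix.toEuclideanCLM (𝕜 := ℝ) (A i)) x⟫ - b i) • A i) :
    ∀ x : EuclideanSpace ℝ (Fin p),
      ‖Matrix.toEuclideanCLM (𝕜 := ℝ) (H x)‖ ≤
        2 * lamBar * ‖x‖ ^ 2 + 2 * Real.sqrt (lamBar * f x) := by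
  intro x
  have hn' : (0 : ℝ) < n := Nat.cast_pos.mpr hn
  have hL : 0 ≤ lamBar := hlam.le.trans hlam'
  have hf0 : 0 ≤ f x := by
    rw [hf]
    positivity
  refine ContinuousLinearMap.opNorm_le_of_inner_le _ (by positivity) fun u v => ?_
  have hbound (u v : EuclideanSpace ℝ (Fin p)) :
      (1 / n : ℝ) * ∑ i, ⟪u, (Matrix.toEuclideanCLM (𝕜 := ℝ) (A i)) v⟫ ^ 2 ≤
        (√lamBar * ‖u‖ * ‖v‖) ^ 2 := by
    rw [mul_pow, mul_pow, Real.sq_sqrt hL]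
    exact (hAss u v).2
  have hres : (1 / n : ℝ) *
      ∑ i, (⟪x, (Matrix.toEuclideanCLM (𝕜 := ℝ) (A i)) x⟫ - b i) ^ 2 ≤ (2 * √(f x)) ^ 2 := by
    rw [mul_pow, Real.sq_sqrt hf0, hf]
    apply le_of_eq
    field_simp
    norm_num
  have h₁ := mul_sum_mul_le_of_mul_sum_sq_le (by positivity) (by positivity) (by positivity)
    _ _ (hbound u x) (hbound x v)
  have h₂ := mul_sum_mul_le_of_mul_sum_sq_le (by positivity) (by positivity) (by positivity)
    _ _ hres (hbound u v)
  have hform : ⟪u, Matrix.toEuclideanCLM (𝕜 := ℝ) (H x) v⟫ =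
      2 * ((1 / n : ℝ) * ∑ i, ⟪u, Matrix.toEuclideanCLM (𝕜 := ℝ) (A i) x⟫ *
        ⟪x, Matrix.toEuclideanCLM (𝕜 := ℝ) (A i) v⟫) +
      (1 / n : ℝ) * ∑ i, (⟪x, Matrix.toEuclideanCLM (𝕜 := ℝ) (A i) x⟫ - b i) *
        ⟪u, Matrix.toEuclideanCLM (𝕜 := ℝ) (A i) v⟫ := by
    rw [hH]
    simp only [map_add, map_smul, map_sum, add_apply,
      smul_apply, sum_apply, inner_add_right,
      inner_smul_right, inner_sum, inner_toEuclideanCLM_mul_vecMulVec_mul]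
    ring
  rw [hform, Real.sqrt_mul hL]
  calc _ ≤ 2 * (√lamBar * ‖u‖ * ‖x‖ * (√lamBar * ‖x‖ * ‖v‖)) +
        2 * √(f x) * (√lamBar * ‖u‖ * ‖v‖) := by linarith
    _ = (2 * √lamBar ^ 2 * ‖x‖ ^ 2 + 2 * (√lamBar * √(f x))) * ‖u‖ * ‖v‖ := by ring
    _ = _ := by rw [Real.sq_sqrt hL]
end

section
/- Suppose Assumption 1 holds. Then for all x, y ∈ ℝᵖ, the gradient of f satisfies ‖∇f(x) − ∇f(y)‖ ≤ ‖∇²f(x)‖ · ‖x − y‖ + 2 λ̄ (‖x‖ + ‖y‖) ‖x − y‖², where ‖∇²f(x)‖ is the spectral norm of the Hessian of f at x. -/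
open scoped RealInnerProductSpace

/-- Cauchy–Schwarz bound for the mean of `⟪u, T i v⟫ • T i w` when the quadratic means of the
bilinear forms `⟪·, T i ·⟫` are bounded. -/
theorem norm_mean_inner_smul_le {ι E : Type*} [Fintype ι] [NormedAddCommGroup E]
    [InnerProductSpace ℝ E] (T : ι → E →L[ℝ] E) {c L : ℝ} (hc : 0 ≤ c) (hL : 0 ≤ L)
    (hT : ∀ u v : E, c * ∑ i, ⟪u, T i v⟫ ^ 2 ≤ L * ‖u‖ ^ 2 * ‖v‖ ^ 2) (u v w : E) :
    ‖c • ∑ i, ⟪u, T i v⟫ • T i w‖ ≤ L * ‖u‖ * ‖v‖ * ‖w‖ := by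
  set z := c • ∑ i, ⟪u, T i v⟫ • T i w with hz
  have hzz : ‖z‖ ^ 2 = c * ∑ i, ⟪u, T i v⟫ * ⟪z, T i w⟫ := by
    rw [← real_inner_self_eq_norm_sq]
    conv_lhs => rw [hz, inner_smul_left, sum_inner, ← hz]
    simp only [inner_smul_left, conj_trivial]
    simp only [real_inner_comm]
  have hcs := Finset.sum_mul_sq_le_sq_mul_sq Finset.univ
    (fun i => ⟪u, T i v⟫) (fun i => ⟪z, T i w⟫)
  have hsq : (‖z‖ ^ 2) ^ 2 ≤ (L * ‖u‖ * ‖v‖ * ‖w‖ * ‖z‖) ^ 2 := by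
    calc (‖z‖ ^ 2) ^ 2 = c ^ 2 * (∑ i, ⟪u, T i v⟫ * ⟪z, T i w⟫) ^ 2 := by rw [hzz, mul_pow]
      _ ≤ c ^ 2 * ((∑ i, ⟪u, T i v⟫ ^ 2) * ∑ i, ⟪z, T i w⟫ ^ 2) := by gcongr
      _ = (c * ∑ i, ⟪u, T i v⟫ ^ 2) * (c * ∑ i, ⟪z, T i w⟫ ^ 2) := by ring
      _ ≤ (L * ‖u‖ ^ 2 * ‖v‖ ^ 2) * (L * ‖z‖ ^ 2 * ‖w‖ ^ 2) :=
        mul_le_mul (hT u v) (hT z w) (by positivity) (by positivity)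
      _ = (L * ‖u‖ * ‖v‖ * ‖w‖ * ‖z‖) ^ 2 := by ring
  have hle := (sq_le_sq₀ (by positivity) (by positivity)).1 hsq
  rcases (norm_nonneg z).eq_or_lt with h0 | h0
  · rw [← h0]; positivity
  · exact le_of_mul_le_mul_right (by rwa [← sq]) h0

theorem toEuclideanCLM_vecMulVec_apply {ι : Type*} [Fintype ι] [DecidableEq ι]
    (x y v : EuclideanSpace ℝ ι) :
    Matrix.toEuclideanCLM (𝕜 := ℝ) (Matrix.vecMulVec (x : ι → ℝ) (y : ι → ℝ)) v = ⟪y, v⟫ • x := by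
  ext j
  simp [Matrix.vecMulVec_mulVec, PiLp.inner_apply, dotProduct, mul_comm]

theorem inner_toEuclideanCLM_comm_of_isSymm {ι : Type*} [Fintype ι] [DecidableEq ι]
    {M : Matrix ι ι ℝ} (hM : M.IsSymm) (u v : EuclideanSpace ℝ ι) :
    ⟪u, Matrix.toEuclideanCLM (𝕜 := ℝ) M v⟫ = ⟪v, Matrix.toEuclideanCLM (𝕜 := ℝ) M u⟫ := by
  have hadj : ContinuousLinearMap.adjoint (Matrix.toEuclideanCLM (𝕜 := ℝ) M) =
      Matrix.toEuclideanCLM (𝕜 := ℝ) M := by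
    rw [← ContinuousLinearMap.star_eq_adjoint, ← map_star, Matrix.star_eq_conjTranspose,
      Matrix.conjTranspose_eq_transpose_of_trivial, hM.eq]
  rw [← ContinuousLinearMap.adjoint_inner_left, hadj, real_inner_comm]

/-- Under Assumption 1, the gradient of `f` satisfies
`‖∇f(x) − ∇f(y)‖ ≤ ‖∇²f(x)‖ ‖x − y‖ + 2 λ̄ (‖x‖ + ‖y‖) ‖x − y‖²`. -/
theorem stmt_4 {n p : ℕ} (hn : 0 < n) (hp : 0 < p)
    (A : Fin n → Matrix (Fin p) (Fin p) ℝ) (hA : ∀ i, (A i).IsSymm)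
    (b : Fin n → ℝ) (lam lamBar : ℝ) (hlam : 0 < lam) (hlam' : lam ≤ lamBar)
    (hAss : ∀ u v : EuclideanSpace ℝ (Fin p),
      lam * ‖u‖ ^ 2 * ‖v‖ ^ 2 ≤
          (1 / n : ℝ) * ∑ i, ⟪u, (Matrix.toEuclideanCLM (𝕜 := ℝ) (A i)) v⟫ ^ 2 ∧
        (1 / n : ℝ) * ∑ i, ⟪u, (Matrix.toEuclideanCLM (𝕜 := ℝ) (A i)) v⟫ ^ 2 ≤
          lamBar * ‖u‖ ^ 2 * ‖v‖ ^ 2)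
    (g : EuclideanSpace ℝ (Fin p) → EuclideanSpace ℝ (Fin p))
    (hg : ∀ x, g x = (1 / n : ℝ) •
      ∑ i, (⟪x, (Matrix.toEuclideanCLM (𝕜 := ℝ) (A i)) x⟫ - b i) •
        (Matrix.toEuclideanCLM (𝕜 := ℝ) (A i)) x)
    (H : EuclideanSpace ℝ (Fin p) → Matrix (Fin p) (Fin p) ℝ)
    (hH : ∀ x, H x =
      (2 / n : ℝ) • ∑ i, A i * Matrix.vecMulVec (x : Fin p → ℝ) (x : Fin p → ℝ) * A i +
      (1 / n : ℝ) • ∑ i, (⟪x, (Matrix.toEuclideanCLM (𝕜 := ℝ) (A i)) x⟫ - b i) • A i) :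
    ∀ x y : EuclideanSpace ℝ (Fin p),
      ‖g x - g y‖ ≤ ‖Matrix.toEuclideanCLM (𝕜 := ℝ) (H x)‖ * ‖x - y‖ +
        2 * lamBar * (‖x‖ + ‖y‖) * ‖x - y‖ ^ 2 := by
  intro x y
  have hL : 0 ≤ lamBar := hlam.le.trans hlam'
  have hbound := norm_mean_inner_smul_le (fun i => Matrix.toEuclideanCLM (𝕜 := ℝ) (A i))
    (c := 1 / n) (by positivity) hL fun u v => (hAss u v).2
  obtain ⟨h, rfl⟩ : ∃ h, y = x + h := ⟨y - x, by abel⟩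
  have hexp : g x - g (x + h) = -(Matrix.toEuclideanCLM (𝕜 := ℝ) (H x) h +
      ((2 : ℝ) • ((1 / n : ℝ) • ∑ i, ⟪x, Matrix.toEuclideanCLM (𝕜 := ℝ) (A i) h⟫ •
          Matrix.toEuclideanCLM (𝕜 := ℝ) (A i) h) +
        (1 / n : ℝ) • ∑ i, ⟪h, Matrix.toEuclideanCLM (𝕜 := ℝ) (A i) h⟫ •
          Matrix.toEuclideanCLM (𝕜 := ℝ) (A i) (x + h))) := by
    have hHx : Matrix.toEuclideanCLM (𝕜 := ℝ) (H x) h =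
        (2 : ℝ) • ((1 / n : ℝ) • ∑ i, ⟪x, Matrix.toEuclideanCLM (𝕜 := ℝ) (A i) h⟫ •
          Matrix.toEuclideanCLM (𝕜 := ℝ) (A i) x) +
        (1 / n : ℝ) • ∑ i, (⟪x, Matrix.toEuclideanCLM (𝕜 := ℝ) (A i) x⟫ - b i) •
          Matrix.toEuclideanCLM (𝕜 := ℝ) (A i) h := by
      rw [hH, smul_smul, mul_one_div]
      simp only [map_add, map_smul, map_sum, map_mul, add_apply, smul_apply, sum_apply,
        ContinuousLinearMap.mul_def, ContinuousLinearMap.comp_apply,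
        toEuclideanCLM_vecMulVec_apply]
    rw [hHx, hg, hg]
    simp only [smul_comm (2 : ℝ) (1 / n : ℝ), ← smul_add, ← smul_sub, ← smul_neg,
      Finset.smul_sum, ← Finset.sum_add_distrib, ← Finset.sum_sub_distrib,
      ← Finset.sum_neg_distrib]
    refine Finset.sum_congr rfl fun i _ => congrArg _ ?_
    simp only [map_add, inner_add_left, inner_add_right,
      inner_toEuclideanCLM_comm_of_isSymm (hA i) h x]
    module
  have hxy : ‖x - (x + h)‖ = ‖h‖ := by simp
  rw [hexp, norm_neg, hxy]
  calc _ ≤ ‖Matrix.toEuclideanCLM (𝕜 := ℝ) (H x)‖ * ‖h‖ +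
        (2 * (lamBar * ‖x‖ * ‖h‖ * ‖h‖) + lamBar * ‖h‖ * ‖h‖ * ‖x + h‖) := by
        refine norm_add_le_of_le (ContinuousLinearMap.le_opNorm _ _)
          (norm_add_le_of_le ?_ (hbound h h (x + h)))
        rw [norm_smul, Real.norm_ofNat]
        exact mul_le_mul_of_nonneg_left (hbound x h h) zero_le_two
    _ ≤ _ := by
        have : 0 ≤ lamBar * ‖h‖ * ‖h‖ * ‖x + h‖ := by positivity
        linarith
end

section
/- Suppose Assumption 1 holds, x* ∈ ℝᵖ with x* ≠ 0, ε ∈ ℝⁿ, and b_i = ⟨x*, A_i x*⟩ + ε_i for every i = 1,…,n. If x̂ ∈ ℝᵖ satisfies f(x̂) ≤ f(x*), then min{‖x̂ − x*‖, ‖x̂ + x*‖} ≤ (2/(λ ‖x*‖)) · sup over u, v in the closed Euclidean unit ball of ℝᵖ of |(1/n) Σ_{i=1}^n ⟨u, A_i v⟩ ε_i|. -/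
open scoped RealInnerProductSpace

/-- A bilinear form `⟪u, T v⟫` is controlled by its supremum over the closed unit ball. -/
theorem abs_inner_le_norm_mul_iSup_closedBall {E : Type*} [NormedAddCommGroup E]
    [InnerProductSpace ℝ E] (T : E →L[ℝ] E) (u v : E) :
    |⟪u, T v⟫| ≤ ‖u‖ * ‖v‖ *
      ⨆ u : Metric.closedBall (0 : E) 1, ⨆ v : Metric.closedBall (0 : E) 1,
        |⟪(u : E), T (v : E)⟫| := by
  have hne : Nonempty (Metric.closedBall (0 : E) 1) := ⟨⟨0, by simp⟩⟩
  have hbd : ∀ a b : Metric.closedBall (0 : E) 1, |⟪(a : E), T (b : E)⟫| ≤ ‖T‖ := by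
    rintro ⟨a, ha⟩ ⟨b, hb⟩
    rw [mem_closedBall_zero_iff] at ha hb
    calc |⟪a, T b⟫| ≤ ‖a‖ * ‖T b‖ := abs_real_inner_le_norm a (T b)
      _ ≤ 1 * (‖T‖ * 1) := by
        gcongr
        exact (T.le_opNorm b).trans (by gcongr)
      _ = ‖T‖ := by ring
  have hle : ∀ a b : Metric.closedBall (0 : E) 1, |⟪(a : E), T (b : E)⟫| ≤
      ⨆ u : Metric.closedBall (0 : E) 1, ⨆ v : Metric.closedBall (0 : E) 1,
        |⟪(u : E), T (v : E)⟫| := fun a b =>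
    (le_ciSup (f := fun v : Metric.closedBall (0 : E) 1 => |⟪(a : E), T (v : E)⟫|)
      ⟨‖T‖, Set.forall_mem_range.2 (hbd a)⟩ b).trans
      (le_ciSup (f := fun u : Metric.closedBall (0 : E) 1 =>
          ⨆ v : Metric.closedBall (0 : E) 1, |⟪(u : E), T (v : E)⟫|)
        ⟨‖T‖, Set.forall_mem_range.2 fun c => ciSup_le (hbd c)⟩ a)
  rcases eq_or_ne u 0 with rfl | hu
  · simp
  rcases eq_or_ne v 0 with rfl | hv
  · simp
  have hmem : ∀ w : E, w ≠ 0 → ‖w‖⁻¹ • w ∈ Metric.closedBall (0 : E) 1 := fun w hw => by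
    rw [mem_closedBall_zero_iff, norm_smul, norm_inv, norm_norm,
      inv_mul_cancel₀ (norm_ne_zero_iff.2 hw)]
  have hu' := norm_pos_iff.2 hu
  have hv' := norm_pos_iff.2 hv
  have key := hle ⟨_, hmem u hu⟩ ⟨_, hmem v hv⟩
  calc |⟪u, T v⟫| = ‖u‖ * ‖v‖ * |⟪‖u‖⁻¹ • u, T (‖v‖⁻¹ • v)⟫| := by
        rw [map_smul, real_inner_smul_left, real_inner_smul_right, abs_mul, abs_mul,
          abs_of_pos (inv_pos.2 hu'), abs_of_pos (inv_pos.2 hv')]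
        field_simp
    _ ≤ _ := mul_le_mul_of_nonneg_left key (by positivity)

/-- A symmetric matrix satisfies the polarization identity
`⟪x - y, A (x + y)⟫ = ⟪x, A x⟫ - ⟪y, A y⟫`. -/
theorem Matrix.IsSymm.inner_sub_toEuclideanCLM_add {ι : Type*} [Fintype ι] [DecidableEq ι]
    {A : Matrix ι ι ℝ} (hA : A.IsSymm) (x y : EuclideanSpace ℝ ι) :
    ⟪x - y, (Matrix.toEuclideanCLM (𝕜 := ℝ) A) (x + y)⟫ =
      ⟪x, (Matrix.toEuclideanCLM (𝕜 := ℝ) A) x⟫ -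
        ⟪y, (Matrix.toEuclideanCLM (𝕜 := ℝ) A) y⟫ := by
  have hadj : IsSelfAdjoint (Matrix.toEuclideanCLM (𝕜 := ℝ) A) := by
    rw [IsSelfAdjoint, ← map_star, Matrix.star_eq_conjTranspose,
      Matrix.conjTranspose_eq_transpose_of_trivial, hA.eq]
  have hsymm := hadj.isSymmetric x y
  rw [ContinuousLinearMap.coe_coe, real_inner_comm] at hsymm
  rw [map_add, inner_sub_left, inner_add_right, inner_add_right, ← hsymm]
  ring

/-- The larger of `‖x - y‖` and `‖x + y‖` is at least `‖y‖`, in product form. -/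
theorem min_norm_sub_norm_add_mul_norm_le {E : Type*} [NormedAddCommGroup E]
    [NormedSpace ℝ E] (x y : E) :
    min ‖x - y‖ ‖x + y‖ * ‖y‖ ≤ ‖x - y‖ * ‖x + y‖ := by
  have hy : 2 * ‖y‖ ≤ ‖x - y‖ + ‖x + y‖ := by
    have h : (2 : ℝ) • y = (x + y) - (x - y) := by module
    calc 2 * ‖y‖ = ‖(2 : ℝ) • y‖ := by rw [norm_smul, Real.norm_ofNat]
      _ ≤ ‖x - y‖ + ‖x + y‖ := by
        rw [h, add_comm ‖x - y‖]
        exact norm_sub_le (x + y) (x - y)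
  rcases le_total ‖x - y‖ ‖x + y‖ with h | h
  · rw [min_eq_left h]
    exact mul_le_mul_of_nonneg_left (by linarith) (norm_nonneg _)
  · rw [min_eq_right h, mul_comm ‖x - y‖]
    exact mul_le_mul_of_nonneg_left (by linarith) (norm_nonneg _)

/-- Under Assumption 1, with noisy measurements
`bᵢ = ⟨x*, Aᵢ x*⟩ + εᵢ` and `x* ≠ 0`, any `x̂` with `f(x̂) ≤ f(x*)` satisfies
`min{‖x̂ − x*‖, ‖x̂ + x*‖} ≤ (2/(λ‖x*‖)) sup_{u,v ∈ 𝔹} |(1/n) ∑ᵢ ⟨u, Aᵢ v⟩ εᵢ|`. -/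
theorem stmt_9 {n p : ℕ} (hn : 0 < n) (hp : 0 < p)
    (A : Fin n → Matrix (Fin p) (Fin p) ℝ) (hA : ∀ i, (A i).IsSymm)
    (b ε : Fin n → ℝ) (lam lamBar : ℝ) (hlam : 0 < lam) (hlam' : lam ≤ lamBar)
    (hAss : ∀ u v : EuclideanSpace ℝ (Fin p),
      lam * ‖u‖ ^ 2 * ‖v‖ ^ 2 ≤
          (1 / n : ℝ) * ∑ i, ⟪u, (Matrix.toEuclideanCLM (𝕜 := ℝ) (A i)) v⟫ ^ 2 ∧
        (1 / n : ℝ) * ∑ i, ⟪u, (Matrix.toEuclideanCLM (𝕜 := ℝ) (A i)) v⟫ ^ 2 ≤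
          lamBar * ‖u‖ ^ 2 * ‖v‖ ^ 2)
    (xs : EuclideanSpace ℝ (Fin p)) (hxs : xs ≠ 0)
    (hb : ∀ i, b i = ⟪xs, (Matrix.toEuclideanCLM (𝕜 := ℝ) (A i)) xs⟫ + ε i)
    (f : EuclideanSpace ℝ (Fin p) → ℝ)
    (hf : ∀ x, f x = (1 / (4 * n) : ℝ) *
      ∑ i, (⟪x, (Matrix.toEuclideanCLM (𝕜 := ℝ) (A i)) x⟫ - b i) ^ 2)
    (xhat : EuclideanSpace ℝ (Fin p)) (hxhat : f xhat ≤ f xs) :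
    min ‖xhat - xs‖ ‖xhat + xs‖ ≤ 2 / (lam * ‖xs‖) *
      ⨆ u : Metric.closedBall (0 : EuclideanSpace ℝ (Fin p)) 1,
        ⨆ v : Metric.closedBall (0 : EuclideanSpace ℝ (Fin p)) 1,
          |(1 / n : ℝ) * ∑ i, ⟪(u : EuclideanSpace ℝ (Fin p)),
            (Matrix.toEuclideanCLM (𝕜 := ℝ) (A i)) (v : EuclideanSpace ℝ (Fin p))⟫ * ε i| := by
  have hn' : (0 : ℝ) < n := Nat.cast_pos.2 hn
  have hxs' : 0 < ‖xs‖ := norm_pos_iff.2 hxs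
  set T : EuclideanSpace ℝ (Fin p) →L[ℝ] EuclideanSpace ℝ (Fin p) :=
    (1 / n : ℝ) • ∑ i, ε i • Matrix.toEuclideanCLM (𝕜 := ℝ) (A i) with hT
  have hTapp : ∀ u v : EuclideanSpace ℝ (Fin p),
      (1 / n : ℝ) * ∑ i, ⟪u, (Matrix.toEuclideanCLM (𝕜 := ℝ) (A i)) v⟫ * ε i =
        ⟪u, T v⟫ := fun u v => by
    simp only [hT, smul_apply, sum_apply,
      real_inner_smul_right, inner_sum, mul_comm (ε _)]
  simp only [hTapp]
  have hbound := abs_inner_le_norm_mul_iSup_closedBall T (xhat - xs) (xhat + xs)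
  set S := ⨆ u : Metric.closedBall (0 : EuclideanSpace ℝ (Fin p)) 1,
    ⨆ v : Metric.closedBall (0 : EuclideanSpace ℝ (Fin p)) 1,
      |⟪(u : EuclideanSpace ℝ (Fin p)), T (v : EuclideanSpace ℝ (Fin p))⟫|
  have hS : 0 ≤ S := Real.iSup_nonneg fun _ => Real.iSup_nonneg fun _ => abs_nonneg _
  have hbasic : ∑ i, ⟪xhat - xs, (Matrix.toEuclideanCLM (𝕜 := ℝ) (A i)) (xhat + xs)⟫ ^ 2 ≤
      2 * ∑ i, ⟪xhat - xs, (Matrix.toEuclideanCLM (𝕜 := ℝ) (A i)) (xhat + xs)⟫ * ε i := by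
    rw [hf, hf] at hxhat
    have h := le_of_mul_le_mul_left hxhat (by positivity)
    rw [← sub_nonneg, ← Finset.sum_sub_distrib] at h
    rw [← sub_nonneg, Finset.mul_sum, ← Finset.sum_sub_distrib]
    refine h.trans_eq (Finset.sum_congr rfl fun i _ => ?_)
    rw [(hA i).inner_sub_toEuclideanCLM_add, hb i]
    ring
  have hquad : lam * ‖xhat - xs‖ ^ 2 * ‖xhat + xs‖ ^ 2 ≤
      2 * (‖xhat - xs‖ * ‖xhat + xs‖ * S) := by
    refine (hAss _ _).1.trans ?_
    refine (mul_le_mul_of_nonneg_left hbasic (by positivity)).trans ?_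
    rw [mul_left_comm, hTapp]
    linarith [le_abs_self ⟪xhat - xs, T (xhat + xs)⟫]
  have hprod : lam * (‖xhat - xs‖ * ‖xhat + xs‖) ≤ 2 * S := by
    rcases (mul_nonneg (norm_nonneg (xhat - xs)) (norm_nonneg (xhat + xs))).eq_or_lt with h | h
    · rw [← h]
      linarith
    · refine le_of_mul_le_mul_left ?_ h
      linarith
  rw [div_mul_eq_mul_div, le_div_iff₀ (by positivity)]
  calc min ‖xhat - xs‖ ‖xhat + xs‖ * (lam * ‖xs‖)
      = lam * (min ‖xhat - xs‖ ‖xhat + xs‖ * ‖xs‖) := by ring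
    _ ≤ lam * (‖xhat - xs‖ * ‖xhat + xs‖) :=
      mul_le_mul_of_nonneg_left (min_norm_sub_norm_add_mul_norm_le xhat xs) hlam.le
    _ ≤ 2 * S := hprod
end

section
/- Let H be a symmetric positive semi-definite p×p real matrix, g ∈ ℝᵖ with g ≠ 0, β > 0, and δ ∈ (0,1). Then the matrix H + β‖g‖^δ I is positive definite (hence invertible), and the regularized Newton direction d = −(H + β‖g‖^δ I)⁻¹ g satisfies: (i) ⟨g, d⟩ ≤ −β ‖g‖^δ ‖d‖² < 0, and (ii) ‖d‖ ≤ β⁻¹ ‖g‖^{1−δ}. -/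
open scoped RealInnerProductSpace

theorem posSemidef_of_forall_inner_nonneg {n : Type*} [Fintype n] [DecidableEq n]
    {H : Matrix n n ℝ} (hHsymm : H.IsSymm)
    (hH : ∀ v : EuclideanSpace ℝ n, 0 ≤ ⟪v, (Matrix.toEuclideanCLM (𝕜 := ℝ) H) v⟫) :
    H.PosSemidef := by
  refine Matrix.PosSemidef.of_dotProduct_mulVec_nonneg
    ((Matrix.conjTranspose_eq_transpose_of_trivial H).trans hHsymm) fun v ↦ ?_
  simpa [EuclideanSpace.inner_eq_star_dotProduct, dotProduct_comm] using hH (WithLp.toLp 2 v)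

theorem toEuclideanCLM_apply_toEuclideanCLM_inv {n : Type*} [Fintype n] [DecidableEq n]
    {A : Matrix n n ℝ} (hA : IsUnit A) (v : EuclideanSpace ℝ n) :
    Matrix.toEuclideanCLM (𝕜 := ℝ) A (Matrix.toEuclideanCLM (𝕜 := ℝ) A⁻¹ v) = v := by
  rw [← mul_apply_eq_comp, ← map_mul,
    Matrix.mul_nonsing_inv A ((Matrix.isUnit_iff_isUnit_det A).1 hA), map_one,
    one_apply_eq_self]

/-- For a symmetric positive semi-definite `H`, `g ≠ 0`, `β > 0` and
`δ ∈ (0,1)`, the matrix `H + β‖g‖^δ I` is positive definite, and the regularized Newton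
direction `d = −(H + β‖g‖^δ I)⁻¹ g` satisfies `⟨g, d⟩ ≤ −β‖g‖^δ‖d‖² < 0` and
`‖d‖ ≤ β⁻¹‖g‖^{1−δ}`. -/
theorem stmt_12 {p : ℕ} (H : Matrix (Fin p) (Fin p) ℝ) (hHsymm : H.IsSymm)
    (hH : ∀ v : EuclideanSpace ℝ (Fin p), 0 ≤ ⟪v, (Matrix.toEuclideanCLM (𝕜 := ℝ) H) v⟫)
    (g : EuclideanSpace ℝ (Fin p)) (hg : g ≠ 0)
    (β δ : ℝ) (hβ : 0 < β) (hδ : δ ∈ Set.Ioo (0 : ℝ) 1) :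
    (H + (β * ‖g‖ ^ δ) • (1 : Matrix (Fin p) (Fin p) ℝ)).PosDef ∧
      ∀ d : EuclideanSpace ℝ (Fin p),
        d = -((Matrix.toEuclideanCLM (𝕜 := ℝ)
            ((H + (β * ‖g‖ ^ δ) • (1 : Matrix (Fin p) (Fin p) ℝ))⁻¹)) g) →
          ⟪g, d⟫ ≤ -(β * ‖g‖ ^ δ) * ‖d‖ ^ 2 ∧ ⟪g, d⟫ < 0 ∧
            ‖d‖ ≤ β⁻¹ * ‖g‖ ^ (1 - δ) := by
  have hgn : 0 < ‖g‖ := norm_pos_iff.2 hg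
  have hpow : 0 < ‖g‖ ^ δ := Real.rpow_pos_of_pos hgn δ
  have hc : 0 < β * ‖g‖ ^ δ := mul_pos hβ hpow
  have hrhs : β⁻¹ * ‖g‖ ^ (1 - δ) = ‖g‖ / (β * ‖g‖ ^ δ) := by
    rw [Real.rpow_sub hgn, Real.rpow_one]
    field_simp
  rw [hrhs]
  generalize β * ‖g‖ ^ δ = c at hc ⊢
  have hpd : (H + c • (1 : Matrix (Fin p) (Fin p) ℝ)).PosDef :=
    Matrix.PosDef.posSemidef_add (posSemidef_of_forall_inner_nonneg hHsymm hH)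
      (Matrix.PosDef.one.smul hc)
  refine ⟨hpd, fun d hd ↦ ?_⟩
  have hgd : g = -(Matrix.toEuclideanCLM (𝕜 := ℝ) H d + c • d) := by
    have h := toEuclideanCLM_apply_toEuclideanCLM_inv hpd.isUnit g
    rw [← neg_eq_iff_eq_neg.2 hd, map_neg, map_add, map_smul, map_one] at h
    simpa using h.symm
  have hinner : ⟪g, d⟫ = -(⟪d, Matrix.toEuclideanCLM (𝕜 := ℝ) H d⟫ + c * ‖d‖ ^ 2) := by
    rw [real_inner_comm, hgd, inner_neg_right, inner_add_right, real_inner_smul_right,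
      real_inner_self_eq_norm_sq]
  have hd0 : 0 < ‖d‖ := by
    rw [norm_pos_iff]
    rintro rfl
    exact hg (by simpa using hgd)
  have hle : ⟪g, d⟫ ≤ -c * ‖d‖ ^ 2 := by linarith [hH d]
  have hcd : 0 < c * ‖d‖ ^ 2 := by positivity
  refine ⟨hle, by linarith, ?_⟩
  rw [le_div_iff₀ hc]
  have hcs := neg_le_of_abs_le (abs_real_inner_le_norm g d)
  refine le_of_mul_le_mul_right ?_ hd0
  linarith
end

section
/- Suppose Assumption 1 holds. Then for any vectors a, b ∈ ℝᵖ, the symmetric matrix (1/n) Σ_{i=1}^n ⟨a, A_i b⟩ A_i has spectral norm at most λ̄ ‖a‖ ‖b‖. -/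
open scoped RealInnerProductSpace

/-- Under Assumption 1, for any vectors `a, b ∈ ℝᵖ`, the symmetric matrix
`(1/n) ∑ᵢ ⟨a, Aᵢ b⟩ Aᵢ` has spectral norm at most `λ̄ ‖a‖ ‖b‖`. -/
theorem stmt_14 {n p : ℕ} (hn : 0 < n) (hp : 0 < p)
    (A : Fin n → Matrix (Fin p) (Fin p) ℝ) (hA : ∀ i, (A i).IsSymm)
    (lam lamBar : ℝ) (hlam : 0 < lam) (hlam' : lam ≤ lamBar)
    (hAss : ∀ u v : EuclideanSpace ℝ (Fin p),
      lam * ‖u‖ ^ 2 * ‖v‖ ^ 2 ≤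
          (1 / n : ℝ) * ∑ i, ⟪u, (Matrix.toEuclideanCLM (𝕜 := ℝ) (A i)) v⟫ ^ 2 ∧
        (1 / n : ℝ) * ∑ i, ⟪u, (Matrix.toEuclideanCLM (𝕜 := ℝ) (A i)) v⟫ ^ 2 ≤
          lamBar * ‖u‖ ^ 2 * ‖v‖ ^ 2) :
    ∀ a b : EuclideanSpace ℝ (Fin p),
      ‖Matrix.toEuclideanCLM (𝕜 := ℝ)
          ((1 / n : ℝ) • ∑ i, ⟪a, (Matrix.toEuclideanCLM (𝕜 := ℝ) (A i)) b⟫ • A i)‖ ≤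
        lamBar * ‖a‖ * ‖b‖ := by
  intro a b
  have hL : 0 ≤ lamBar := hlam.le.trans hlam'
  refine ContinuousLinearMap.opNorm_le_bound _ (by positivity) fun v => ?_
  set w := Matrix.toEuclideanCLM (𝕜 := ℝ)
    ((1 / n : ℝ) • ∑ i, ⟪a, (Matrix.toEuclideanCLM (𝕜 := ℝ) (A i)) b⟫ • A i) v with hw
  have hww : ‖w‖ ^ 2 = (1 / n : ℝ) * ∑ i, ⟪a, (Matrix.toEuclideanCLM (𝕜 := ℝ) (A i)) b⟫ *
      ⟪w, (Matrix.toEuclideanCLM (𝕜 := ℝ) (A i)) v⟫ := by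
    rw [← real_inner_self_eq_norm_sq]
    nth_rewrite 2 [hw]
    simp only [map_smul, map_sum, smul_apply, sum_apply,
      inner_smul_right, inner_sum]
  have key : (‖w‖ ^ 2) ^ 2 ≤ (lamBar * ‖a‖ * ‖b‖ * ‖v‖ * ‖w‖) ^ 2 := by
    calc (‖w‖ ^ 2) ^ 2
        ≤ ((1 / n : ℝ) * ∑ i, ⟪a, (Matrix.toEuclideanCLM (𝕜 := ℝ) (A i)) b⟫ ^ 2) *
          ((1 / n : ℝ) * ∑ i, ⟪w, (Matrix.toEuclideanCLM (𝕜 := ℝ) (A i)) v⟫ ^ 2) := by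
          rw [hww, mul_pow, mul_mul_mul_comm, ← sq]
          gcongr
          exact Finset.sum_mul_sq_le_sq_mul_sq _ _ _
      _ ≤ (lamBar * ‖a‖ ^ 2 * ‖b‖ ^ 2) * (lamBar * ‖w‖ ^ 2 * ‖v‖ ^ 2) :=
          mul_le_mul (hAss a b).2 (hAss w v).2 (by positivity) (by positivity)
      _ = _ := by ring
  have h : ‖w‖ ^ 2 ≤ lamBar * ‖a‖ * ‖b‖ * ‖v‖ * ‖w‖ :=
    (sq_le_sq₀ (by positivity) (by positivity)).mp key
  rcases (norm_nonneg w).eq_or_lt with h0 | h0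
  · rw [← h0]
    positivity
  · exact le_of_mul_le_mul_right (by rwa [← sq]) h0
end

section
/- Suppose Assumption 1 holds and let x̄ ∈ ℝᵖ. Write φ_i(x̄) = ⟨x̄, A_i x̄⟩ − b_i. Then for every v ∈ ℝᵖ, ⟨v, ∇²f(x̄) v⟩ ≥ ‖v‖² · (2 λ ‖x̄‖² − ‖(1/n) Σ_{i=1}^n φ_i(x̄) A_i‖), where ‖·‖ on the matrix is the spectral norm. In particular, if ‖(1/n) Σ_{i=1}^n φ_i(x̄) A_i‖ < 2 λ ‖x̄‖², then the Hessian ∇²f(x̄) is positive definite. -/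
open scoped RealInnerProductSpace

/-- The quadratic form of `A x xᵀ A` with `A` symmetric is the square of the form `⟨x, A v⟩`. -/
lemma inner_toEuclideanCLM_mul_vecMulVec_mul_s15 {p : ℕ} {A : Matrix (Fin p) (Fin p) ℝ}
    (hA : A.IsSymm) (x v : EuclideanSpace ℝ (Fin p)) :
    ⟪v, (Matrix.toEuclideanCLM (𝕜 := ℝ)
      (A * Matrix.vecMulVec (x : Fin p → ℝ) (x : Fin p → ℝ) * A)) v⟫ =
      ⟪x, (Matrix.toEuclideanCLM (𝕜 := ℝ) A) v⟫ ^ 2 := by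
  have hdot : ⟪x, (Matrix.toEuclideanCLM (𝕜 := ℝ) A) v⟫ = x.ofLp ⬝ᵥ A.mulVec v.ofLp := by
    rw [EuclideanSpace.inner_eq_star_dotProduct, Matrix.ofLp_toEuclideanCLM, star_trivial,
      dotProduct_comm]
  have hsymm : v.ofLp ⬝ᵥ A.mulVec x.ofLp = x.ofLp ⬝ᵥ A.mulVec v.ofLp := by
    rw [Matrix.dotProduct_mulVec, ← Matrix.mulVec_transpose, hA.eq, dotProduct_comm]
  rw [hdot, EuclideanSpace.inner_eq_star_dotProduct, Matrix.ofLp_toEuclideanCLM, star_trivial,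
    dotProduct_comm, ← Matrix.mulVec_mulVec, ← Matrix.mulVec_mulVec, Matrix.vecMulVec_mulVec,
    op_smul_eq_smul, Matrix.mulVec_smul, dotProduct_smul, hsymm, smul_eq_mul, sq]

/-- A quadratic form is bounded below by minus the operator norm. -/
lemma neg_norm_mul_sq_le_inner {E : Type*} [NormedAddCommGroup E] [InnerProductSpace ℝ E]
    (T : E →L[ℝ] E) (v : E) : -(‖T‖ * ‖v‖ ^ 2) ≤ ⟪v, T v⟫ := by
  have h₁ := neg_le_of_abs_le (abs_real_inner_le_norm v (T v))
  have h₂ := mul_le_mul_of_nonneg_left (T.le_opNorm v) (norm_nonneg v)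
  linarith

/-- Under Assumption 1, with `φᵢ(x̄) = ⟨x̄, Aᵢ x̄⟩ − bᵢ`, the Hessian
`∇²f(x̄) = (2/n) ∑ᵢ Aᵢ x̄ x̄ᵀ Aᵢ + (1/n) ∑ᵢ φᵢ(x̄) Aᵢ` satisfies
`⟨v, ∇²f(x̄) v⟩ ≥ ‖v‖² (2λ‖x̄‖² − ‖(1/n) ∑ᵢ φᵢ(x̄) Aᵢ‖)` for every `v`; in particular
if `‖(1/n) ∑ᵢ φᵢ(x̄) Aᵢ‖ < 2λ‖x̄‖²` then `∇²f(x̄)` is positive definite. -/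
theorem stmt_15 {n p : ℕ} (hn : 0 < n) (hp : 0 < p)
    (A : Fin n → Matrix (Fin p) (Fin p) ℝ) (hA : ∀ i, (A i).IsSymm)
    (b : Fin n → ℝ) (lam lamBar : ℝ) (hlam : 0 < lam) (hlam' : lam ≤ lamBar)
    (hAss : ∀ u v : EuclideanSpace ℝ (Fin p),
      lam * ‖u‖ ^ 2 * ‖v‖ ^ 2 ≤
          (1 / n : ℝ) * ∑ i, ⟪u, (Matrix.toEuclideanCLM (𝕜 := ℝ) (A i)) v⟫ ^ 2 ∧
        (1 / n : ℝ) * ∑ i, ⟪u, (Matrix.toEuclideanCLM (𝕜 := ℝ) (A i)) v⟫ ^ 2 ≤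
          lamBar * ‖u‖ ^ 2 * ‖v‖ ^ 2)
    (H : EuclideanSpace ℝ (Fin p) → Matrix (Fin p) (Fin p) ℝ)
    (hH : ∀ x, H x =
      (2 / n : ℝ) • ∑ i, A i * Matrix.vecMulVec (x : Fin p → ℝ) (x : Fin p → ℝ) * A i +
      (1 / n : ℝ) • ∑ i, (⟪x, (Matrix.toEuclideanCLM (𝕜 := ℝ) (A i)) x⟫ - b i) • A i)
    (xb : EuclideanSpace ℝ (Fin p)) :
    (∀ v : EuclideanSpace ℝ (Fin p),
      ‖v‖ ^ 2 * (2 * lam * ‖xb‖ ^ 2 -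
          ‖Matrix.toEuclideanCLM (𝕜 := ℝ) ((1 / n : ℝ) •
            ∑ i, (⟪xb, (Matrix.toEuclideanCLM (𝕜 := ℝ) (A i)) xb⟫ - b i) • A i)‖) ≤
        ⟪v, (Matrix.toEuclideanCLM (𝕜 := ℝ) (H xb)) v⟫) ∧
    (‖Matrix.toEuclideanCLM (𝕜 := ℝ) ((1 / n : ℝ) •
        ∑ i, (⟪xb, (Matrix.toEuclideanCLM (𝕜 := ℝ) (A i)) xb⟫ - b i) • A i)‖ <
        2 * lam * ‖xb‖ ^ 2 →
      ∀ v : EuclideanSpace ℝ (Fin p), v ≠ 0 →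
        0 < ⟪v, (Matrix.toEuclideanCLM (𝕜 := ℝ) (H xb)) v⟫) := by
  have key : ∀ v : EuclideanSpace ℝ (Fin p),
      ‖v‖ ^ 2 * (2 * lam * ‖xb‖ ^ 2 -
          ‖Matrix.toEuclideanCLM (𝕜 := ℝ) ((1 / n : ℝ) •
            ∑ i, (⟪xb, (Matrix.toEuclideanCLM (𝕜 := ℝ) (A i)) xb⟫ - b i) • A i)‖) ≤
        ⟪v, (Matrix.toEuclideanCLM (𝕜 := ℝ) (H xb)) v⟫ := by
    intro v
    have hres := neg_norm_mul_sq_le_inner (Matrix.toEuclideanCLM (𝕜 := ℝ) ((1 / n : ℝ) •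
      ∑ i, (⟪xb, (Matrix.toEuclideanCLM (𝕜 := ℝ) (A i)) xb⟫ - b i) • A i)) v
    have hlow := (hAss xb v).1
    have hmain : ⟪v, (Matrix.toEuclideanCLM (𝕜 := ℝ) ((2 / n : ℝ) •
        ∑ i, A i * Matrix.vecMulVec (xb : Fin p → ℝ) (xb : Fin p → ℝ) * A i)) v⟫ =
        2 * ((1 / n : ℝ) * ∑ i, ⟪xb, (Matrix.toEuclideanCLM (𝕜 := ℝ) (A i)) v⟫ ^ 2) := by
      rw [map_smul, map_sum, smul_apply, sum_apply,
        real_inner_smul_right, inner_sum]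
      simp_rw [inner_toEuclideanCLM_mul_vecMulVec_mul_s15 (hA _)]
      ring
    rw [hH, map_add, add_apply, inner_add_right, hmain]
    linarith
  refine ⟨key, fun hlt v hv => lt_of_lt_of_le ?_ (key v)⟩
  exact mul_pos (pow_pos (norm_pos_iff.mpr hv) 2) (sub_pos.mpr hlt)
end

section
/- Suppose Assumption 1 holds with λ̄ < 3λ, and the measurements are noiseless: b_i = ⟨x*, A_i x*⟩ for every i = 1,…,n, where x* ∈ ℝᵖ with x* ≠ 0. If x̄ ∈ ℝᵖ satisfies ∇f(x̄) = 0 and the Hessian ∇²f(x̄) is positive semi-definite, then x̄ = x* or x̄ = −x*. -/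
open scoped RealInnerProductSpace

/-- The scalar incompatibility between the moment bounds at a second-order stationary point. -/
lemma moment_bounds_incompatible {X W β R lam lamBar : ℝ} (hX : 0 < X) (hW : 0 < W)
    (hβ : 0 ≤ β) (hlam : 0 < lam) (h3 : lamBar < 3 * lam)
    (hR : lam * ((1 - β) ^ 2 * X ^ 2 + 2 * (1 + β) * X * W + W ^ 2) ≤ R)
    (h0 : R + lam * X * ((1 - β) ^ 2 * X + 4 * β * W) ≤ lamBar * W ^ 2)
    (h1 : (3 + 2 * β) * R + lam * X * (4 * X + 4 * β * W) ≤
      lamBar * (W + (1 + β) * X) ^ 2) : False := by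
  have hlt : (1 + 3 * β) * X < W := by
    have hsq : lamBar * W ^ 2 < 3 * lam * W ^ 2 := by gcongr
    have hneg : lam * (2 * ((1 - β) ^ 2 * X ^ 2) + 2 * W * ((1 + 3 * β) * X - W)) < 0 := by
      linarith
    have hneg' := neg_of_mul_neg_right hneg hlam.le
    have hnn : 0 ≤ (1 - β) ^ 2 * X ^ 2 := by positivity
    have : W * ((1 + 3 * β) * X - W) < 0 := by linarith
    linarith [neg_of_mul_neg_right this hW.le]
  have hsq : lamBar * (W + (1 + β) * X) ^ 2 < 3 * lam * (W + (1 + β) * X) ^ 2 := by gcongr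
  have hR' := mul_le_mul_of_nonneg_left hR (by positivity : 0 ≤ 3 + 2 * β)
  have hneg : lam * (2 * β * (W + (1 + β) * X) ^ 2 + (4 - 12 * β - 8 * β ^ 2) * X ^ 2
      + 4 * β * X * W) < 0 := by linarith
  have hneg' := neg_of_mul_neg_right hneg hlam.le
  have hsum : ((2 + 4 * β) * X) ^ 2 ≤ (W + (1 + β) * X) ^ 2 := by
    gcongr
    linarith
  have hprod : X * ((1 + 3 * β) * X) ≤ X * W := by gcongr
  have e1 := mul_le_mul_of_nonneg_left hsum (by positivity : 0 ≤ 2 * β)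
  have e2 := mul_le_mul_of_nonneg_left hprod (by positivity : 0 ≤ 4 * β)
  have hpos : 0 < (4 + 36 * β ^ 2 + 32 * β ^ 3) * X ^ 2 := by positivity
  linarith

section BilinForm

variable {ι V : Type*} [Fintype ι] [NormedAddCommGroup V] [InnerProductSpace ℝ V]

/-- The parallelogram identity for `w ± t x`, with `y = α x + w`, combined with the stationarity
conditions and the fourth-moment bounds. -/
lemma stationary_moment_bound {B : ι → LinearMap.BilinForm ℝ V}
    (hB : ∀ i u v, B i u v = B i v u) {c lam lamBar : ℝ}
    (hlow : ∀ u v, lam * ‖u‖ ^ 2 * ‖v‖ ^ 2 ≤ c * ∑ i, B i u v ^ 2)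
    (hup : ∀ u v, c * ∑ i, B i u v ^ 2 ≤ lamBar * ‖u‖ ^ 2 * ‖v‖ ^ 2)
    {x y w : V} {α : ℝ} (hy : y = α • x + w) (hxw : ⟪x, w⟫ = 0)
    (hgrad : ∀ v, c * ∑ i, (B i x x - B i y y) * B i x v = 0)
    (hcurv : c * ∑ i, (B i x x - B i y y) ^ 2 ≤ 2 * (c * ∑ i, B i x w ^ 2)) (t : ℝ) :
    (1 + 2 * t ^ 2) * (c * ∑ i, (B i x x - B i y y) ^ 2) +
      lam * ‖x‖ ^ 2 * ((t ^ 2 + 1 - α ^ 2) ^ 2 * ‖x‖ ^ 2 + 4 * α ^ 2 * ‖w‖ ^ 2) ≤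
    lamBar * (‖w‖ ^ 2 + t ^ 2 * ‖x‖ ^ 2) ^ 2 := by
  have hwx : ⟪w, x⟫ = 0 := by rw [real_inner_comm, hxw]
  have norm_add (p q : ℝ) : ‖p • x + q • w‖ ^ 2 = p ^ 2 * ‖x‖ ^ 2 + q ^ 2 * ‖w‖ ^ 2 := by
    rw [← real_inner_self_eq_norm_sq, ← real_inner_self_eq_norm_sq, ← real_inner_self_eq_norm_sq]
    simp only [inner_add_left, inner_add_right, real_inner_smul_left, real_inner_smul_right,
      hxw, hwx]
    ring
  set z : V := (t ^ 2 + 1 - α ^ 2) • x + (-2 * α) • w with hz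
  have hp := hup (t • x + (1 : ℝ) • w) (t • x + (1 : ℝ) • w)
  have hm := hup ((-t) • x + (1 : ℝ) • w) ((-t) • x + (1 : ℝ) • w)
  have hl := hlow x z
  rw [norm_add] at hp hm
  rw [hz, norm_add, ← hz] at hl
  have key : c * ∑ i, B i (t • x + (1 : ℝ) • w) (t • x + (1 : ℝ) • w) ^ 2
      + c * ∑ i, B i ((-t) • x + (1 : ℝ) • w) ((-t) • x + (1 : ℝ) • w) ^ 2
      = 2 * (c * ∑ i, (B i x x - B i y y) ^ 2) + 2 * (c * ∑ i, B i x z ^ 2)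
        + 8 * t ^ 2 * (c * ∑ i, B i x w ^ 2)
        - 4 * (c * ∑ i, (B i x x - B i y y) * B i x z) := by
    simp only [Finset.mul_sum, ← Finset.sum_add_distrib, ← Finset.sum_sub_distrib]
    refine Finset.sum_congr rfl fun i _ => ?_
    simp only [hz, hy, map_add, map_smul, LinearMap.add_apply, LinearMap.smul_apply, smul_eq_mul,
      hB i w x]
    ring
  rw [hgrad] at key
  have := mul_le_mul_of_nonneg_left hcurv (by positivity : 0 ≤ 4 * t ^ 2)
  linarith

/-- A second-order stationary point of the noiseless quartic objective attached to symmetric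
bilinear forms is a global minimizer `±y`. -/
lemma eq_or_eq_neg_of_second_order_stationary {B : ι → LinearMap.BilinForm ℝ V}
    (hB : ∀ i u v, B i u v = B i v u) {c lam lamBar : ℝ}
    (hlam : 0 < lam) (h3 : lamBar < 3 * lam)
    (hlow : ∀ u v, lam * ‖u‖ ^ 2 * ‖v‖ ^ 2 ≤ c * ∑ i, B i u v ^ 2)
    (hup : ∀ u v, c * ∑ i, B i u v ^ 2 ≤ lamBar * ‖u‖ ^ 2 * ‖v‖ ^ 2)
    {x y : V}
    (hgrad : ∀ v, c * ∑ i, (B i x x - B i y y) * B i x v = 0)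
    (hhess : ∀ v, 0 ≤ 2 * (c * ∑ i, B i x v ^ 2) + c * ∑ i, (B i x x - B i y y) * B i v v) :
    x = y ∨ x = -y := by
  obtain ⟨α, w, hy, hxw⟩ : ∃ (α : ℝ) (w : V), y = α • x + w ∧ ⟪x, w⟫ = 0 := by
    refine ⟨⟪x, y⟫ / ‖x‖ ^ 2, y - (⟪x, y⟫ / ‖x‖ ^ 2) • x, by abel, ?_⟩
    rcases eq_or_ne x 0 with rfl | hx
    · simp
    · have : ‖x‖ ≠ 0 := norm_ne_zero_iff.mpr hx
      rw [inner_sub_right, real_inner_smul_right, real_inner_self_eq_norm_sq]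
      field_simp
      ring
  have hwx : ⟪w, x⟫ = 0 := by rw [real_inner_comm, hxw]
  have hcurv : c * ∑ i, (B i x x - B i y y) ^ 2 ≤ 2 * (c * ∑ i, B i x w ^ 2) := by
    have key : c * ∑ i, (B i x x - B i y y) * B i w w
        = c * ∑ i, (B i x x - B i y y) * B i x ((1 - α ^ 2) • x + (-2 * α) • w)
          - c * ∑ i, (B i x x - B i y y) ^ 2 := by
      simp only [Finset.mul_sum, ← Finset.sum_sub_distrib]
      refine Finset.sum_congr rfl fun i _ => ?_
      simp only [hy, map_add, map_smul, LinearMap.add_apply, LinearMap.smul_apply, smul_eq_mul,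
        hB i w x]
      ring
    have := hhess w
    rw [key, hgrad] at this
    linarith
  have hres : lam * ‖x - y‖ ^ 2 * ‖x + y‖ ^ 2 ≤ c * ∑ i, (B i x x - B i y y) ^ 2 := by
    refine (hlow (x - y) (x + y)).trans_eq ?_
    congr 1
    refine Finset.sum_congr rfl fun i _ => ?_
    simp only [map_add, map_sub, LinearMap.sub_apply, hB i y x]
    ring
  have of_degenerate (h : lam * ‖x‖ ^ 2 * ‖w‖ ^ 2 = 0) : x = y ∨ x = -y := by
    have hXW : ‖x‖ ^ 2 * ‖w‖ ^ 2 = 0 := by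
      rw [mul_assoc] at h
      exact (mul_eq_zero.mp h).resolve_left hlam.ne'
    have hu := hup x w
    rw [mul_assoc, hXW, mul_zero] at hu
    have hle : lam * (‖x - y‖ ^ 2 * ‖x + y‖ ^ 2) ≤ 0 := by linarith
    have hz : ‖x - y‖ ^ 2 * ‖x + y‖ ^ 2 = 0 :=
      le_antisymm (nonpos_of_mul_nonpos_right hle hlam) (by positivity)
    rcases mul_eq_zero.mp hz with h' | h'
    · exact Or.inl (sub_eq_zero.mp (by simpa using h'))
    · exact Or.inr (eq_neg_of_add_eq_zero_left (by simpa using h'))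
  rcases eq_or_ne x 0 with hx | hx
  · exact of_degenerate (by simp [hx])
  rcases eq_or_ne w 0 with hw | hw
  · exact of_degenerate (by simp [hw])
  exfalso
  have hX : 0 < ‖x‖ ^ 2 := by positivity
  have hW : 0 < ‖w‖ ^ 2 := by positivity
  have norm_add (p : ℝ) : ‖p • x + w‖ ^ 2 = p ^ 2 * ‖x‖ ^ 2 + ‖w‖ ^ 2 := by
    rw [← real_inner_self_eq_norm_sq, ← real_inner_self_eq_norm_sq, ← real_inner_self_eq_norm_sq]
    simp only [inner_add_left, inner_add_right, real_inner_smul_left, real_inner_smul_right,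
      hxw, hwx]
    ring
  have hsub : ‖x - y‖ ^ 2 = (1 - α) ^ 2 * ‖x‖ ^ 2 + ‖w‖ ^ 2 := by
    rw [norm_sub_rev, show y - x = (α - 1) • x + w by rw [hy]; module, norm_add]
    ring
  have hadd : ‖x + y‖ ^ 2 = (1 + α) ^ 2 * ‖x‖ ^ 2 + ‖w‖ ^ 2 := by
    rw [show x + y = (1 + α) • x + w by rw [hy]; module, norm_add]
  rw [hsub, hadd] at hres
  have h0 := stationary_moment_bound hB hlow hup hy hxw hgrad hcurv 0
  have h1 := stationary_moment_bound hB hlow hup hy hxw hgrad hcurv (√(1 + α ^ 2))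
  rw [Real.sq_sqrt (by positivity)] at h1
  refine moment_bounds_incompatible (R := c * ∑ i, (B i x x - B i y y) ^ 2) hX hW
    (sq_nonneg α) hlam h3 ?_ ?_ ?_
  · linarith
  · linarith
  · linarith

end BilinForm

/-- Under Assumption 1 with `λ̄ < 3λ` and noiseless measurements
`bᵢ = ⟨x*, Aᵢ x*⟩` with `x* ≠ 0`, every second-order stationary point (`∇f(x̄) = 0`
and `∇²f(x̄)` positive semi-definite) satisfies `x̄ = x*` or `x̄ = −x*`. -/
theorem stmt_18 {n p : ℕ} (hn : 0 < n) (hp : 0 < p)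
    (A : Fin n → Matrix (Fin p) (Fin p) ℝ) (hA : ∀ i, (A i).IsSymm)
    (b : Fin n → ℝ) (lam lamBar : ℝ) (hlam : 0 < lam) (hlam' : lam ≤ lamBar)
    (hAss : ∀ u v : EuclideanSpace ℝ (Fin p),
      lam * ‖u‖ ^ 2 * ‖v‖ ^ 2 ≤
          (1 / n : ℝ) * ∑ i, ⟪u, (Matrix.toEuclideanCLM (𝕜 := ℝ) (A i)) v⟫ ^ 2 ∧
        (1 / n : ℝ) * ∑ i, ⟪u, (Matrix.toEuclideanCLM (𝕜 := ℝ) (A i)) v⟫ ^ 2 ≤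
          lamBar * ‖u‖ ^ 2 * ‖v‖ ^ 2)
    (h3 : lamBar < 3 * lam)
    (xs : EuclideanSpace ℝ (Fin p)) (hxs : xs ≠ 0)
    (hb : ∀ i, b i = ⟪xs, (Matrix.toEuclideanCLM (𝕜 := ℝ) (A i)) xs⟫)
    (H : EuclideanSpace ℝ (Fin p) → Matrix (Fin p) (Fin p) ℝ)
    (hH : ∀ x, H x =
      (2 / n : ℝ) • ∑ i, A i * Matrix.vecMulVec (x : Fin p → ℝ) (x : Fin p → ℝ) * A i +
      (1 / n : ℝ) • ∑ i, (⟪x, (Matrix.toEuclideanCLM (𝕜 := ℝ) (A i)) x⟫ - b i) • A i)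
    (xb : EuclideanSpace ℝ (Fin p))
    (hgrad : (1 / n : ℝ) •
      ∑ i, (⟪xb, (Matrix.toEuclideanCLM (𝕜 := ℝ) (A i)) xb⟫ - b i) •
        (Matrix.toEuclideanCLM (𝕜 := ℝ) (A i)) xb = (0 : EuclideanSpace ℝ (Fin p)))
    (hpsd : ∀ v : EuclideanSpace ℝ (Fin p),
      0 ≤ ⟪v, (Matrix.toEuclideanCLM (𝕜 := ℝ) (H xb)) v⟫) :
    xb = xs ∨ xb = -xs := by
  set T : Fin n → EuclideanSpace ℝ (Fin p) →L[ℝ] EuclideanSpace ℝ (Fin p) :=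
    fun i => Matrix.toEuclideanCLM (𝕜 := ℝ) (A i) with hT
  have hsymm (i) (u v : EuclideanSpace ℝ (Fin p)) : ⟪u, T i v⟫ = ⟪v, T i u⟫ := by
    have hstar : star (A i) = A i := by
      rw [Matrix.star_eq_conjTranspose, Matrix.conjTranspose_eq_transpose_of_trivial]
      exact hA i
    have hadj : ContinuousLinearMap.adjoint (T i) = T i := by
      rw [← ContinuousLinearMap.star_eq_adjoint, hT, ← map_star, hstar]
    rw [← ContinuousLinearMap.adjoint_inner_left, hadj, real_inner_comm]
  have hvec (x v : EuclideanSpace ℝ (Fin p)) :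
      Matrix.toEuclideanCLM (𝕜 := ℝ) (Matrix.vecMulVec (x : Fin p → ℝ) (x : Fin p → ℝ)) v
        = ⟪x, v⟫ • x := by
    ext j
    simp [Matrix.vecMulVec_mulVec, PiLp.inner_apply, dotProduct, mul_comm]
  refine eq_or_eq_neg_of_second_order_stationary (c := (1 / n : ℝ))
    (B := fun i => (innerₗ (EuclideanSpace ℝ (Fin p))).compl₂ (T i).toLinearMap)
    (fun i u v => hsymm i u v) hlam h3 (fun u v => (hAss u v).1) (fun u v => (hAss u v).2)
    (fun v => ?_) (fun v => ?_)
  · have h := congrArg (fun z => ⟪v, z⟫) hgrad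
    simp only [real_inner_smul_right, inner_sum, inner_zero_right, hb] at h
    rw [← h]
    congr 1
    exact Finset.sum_congr rfl fun i _ => congrArg _ (hsymm i xb v)
  · refine (hpsd v).trans_eq ?_
    rw [hH]
    simp only [map_add, map_smul, map_sum, map_mul, add_apply, smul_apply, sum_apply,
      mul_apply_eq_comp, hvec, inner_add_right, real_inner_smul_right, inner_sum, hb]
    simp only [LinearMap.compl₂_apply, innerₗ_apply_apply, ContinuousLinearMap.coe_coe]
    congr 1
    simp only [Finset.mul_sum]
    refine Finset.sum_congr rfl fun i _ => ?_
    change _ = 2 * (1 / n * ⟪xb, T i v⟫ ^ 2)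
    have := hsymm i v xb
    change 2 / n * (⟪xb, T i v⟫ * ⟪v, T i xb⟫) = _
    rw [this]
    ring
end

section
/- Suppose Assumption 1 holds, x* ∈ ℝᵖ with x* ≠ 0, ε ∈ ℝⁿ, and b_i = ⟨x*, A_i x*⟩ + ε_i for every i = 1,…,n. Assume further that the noise satisfies |(1/n) Σ_{i=1}^n ε_i ⟨v, A_i v⟩| ≤ λ ‖v‖² ‖x*‖² for every v ∈ ℝᵖ. Then for every x ∈ ℝᵖ with min{‖x − x*‖, ‖x + x*‖} < λ‖x*‖/(4λ + 3λ̄), the Hessian ∇²f(x) is positive definite. -/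
open scoped RealInnerProductSpace

theorem toEuclideanCLM_vecMulVec_apply_s19 {p : ℕ} (x y : EuclideanSpace ℝ (Fin p)) :
    Matrix.toEuclideanCLM (𝕜 := ℝ) (Matrix.vecMulVec (x : Fin p → ℝ) (x : Fin p → ℝ)) y =
      ⟪x, y⟫ • x := by
  ext j
  simp [Matrix.ofLp_toEuclideanCLM, Matrix.vecMulVec_mulVec, PiLp.inner_apply, dotProduct,
    mul_comm]

theorem inner_toEuclideanCLM_comm {p : ℕ} {A : Matrix (Fin p) (Fin p) ℝ} (hA : A.IsSymm)
    (u v : EuclideanSpace ℝ (Fin p)) :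
    ⟪u, Matrix.toEuclideanCLM (𝕜 := ℝ) A v⟫ = ⟪v, Matrix.toEuclideanCLM (𝕜 := ℝ) A u⟫ := by
  have h : star (Matrix.toEuclideanCLM (𝕜 := ℝ) A) = Matrix.toEuclideanCLM (𝕜 := ℝ) A := by
    rw [← map_star, Matrix.star_eq_conjTranspose, Matrix.conjTranspose_eq_transpose_of_trivial, hA]
  rw [ContinuousLinearMap.star_eq_adjoint] at h
  rw [← ContinuousLinearMap.adjoint_inner_left, h, real_inner_comm]

theorem inner_toEuclideanCLM_sub {p : ℕ} {A : Matrix (Fin p) (Fin p) ℝ} (hA : A.IsSymm)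
    (x y : EuclideanSpace ℝ (Fin p)) :
    ⟪x, Matrix.toEuclideanCLM (𝕜 := ℝ) A x⟫ - ⟪y, Matrix.toEuclideanCLM (𝕜 := ℝ) A y⟫ =
      ⟪x - y, Matrix.toEuclideanCLM (𝕜 := ℝ) A (x + y)⟫ := by
  rw [map_add, inner_add_right, inner_sub_left, inner_sub_left, inner_toEuclideanCLM_comm hA x y]
  ring

theorem hessian_quadratic_form {n p : ℕ} {A : Fin n → Matrix (Fin p) (Fin p) ℝ}
    (hA : ∀ i, (A i).IsSymm) (c : Fin n → ℝ) (x v : EuclideanSpace ℝ (Fin p)) :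
    ⟪v, Matrix.toEuclideanCLM (𝕜 := ℝ)
      ((2 / n : ℝ) • ∑ i, A i * Matrix.vecMulVec (x : Fin p → ℝ) (x : Fin p → ℝ) * A i +
        (1 / n : ℝ) • ∑ i, c i • A i) v⟫ =
      2 * ((1 / n : ℝ) * ∑ i, ⟪x, Matrix.toEuclideanCLM (𝕜 := ℝ) (A i) v⟫ ^ 2) +
        (1 / n : ℝ) * ∑ i, c i * ⟪v, Matrix.toEuclideanCLM (𝕜 := ℝ) (A i) v⟫ := by
  simp only [map_add, map_smul, map_sum, map_mul, add_apply, smul_apply,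
    sum_apply, mul_apply_eq_comp, toEuclideanCLM_vecMulVec_apply_s19, inner_add_right,
    inner_smul_right, inner_sum, inner_toEuclideanCLM_comm (hA _) v x, ← pow_two]
  ring

/-- Cauchy–Schwarz for averages, with bounds on the two second moments. -/
theorem neg_le_average_mul {n : ℕ} (a b : Fin n → ℝ) {α β L : ℝ} (hα : 0 ≤ α) (hβ : 0 ≤ β)
    (hL : 0 ≤ L) (ha : (1 / n : ℝ) * ∑ i, a i ^ 2 ≤ L * α ^ 2)
    (hb : (1 / n : ℝ) * ∑ i, b i ^ 2 ≤ L * β ^ 2) :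
    -(L * (α * β)) ≤ (1 / n : ℝ) * ∑ i, a i * b i := by
  refine (abs_le_of_sq_le_sq' ?_ (by positivity)).1
  calc ((1 / n : ℝ) * ∑ i, a i * b i) ^ 2
      = (1 / n : ℝ) ^ 2 * (∑ i, a i * b i) ^ 2 := by ring
    _ ≤ (1 / n : ℝ) ^ 2 * ((∑ i, a i ^ 2) * ∑ i, b i ^ 2) := by
        gcongr
        exact Finset.sum_mul_sq_le_sq_mul_sq _ _ _
    _ = ((1 / n : ℝ) * ∑ i, a i ^ 2) * ((1 / n : ℝ) * ∑ i, b i ^ 2) := by ring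
    _ ≤ (L * α ^ 2) * (L * β ^ 2) := by
        gcongr
    _ = (L * (α * β)) ^ 2 := by ring

theorem curvature_pos {E : Type*} [NormedAddCommGroup E] {x s : E} {lam L : ℝ}
    (hlam : 0 < lam) (hL : lam ≤ L) (h : ‖x - s‖ < lam * ‖s‖ / (4 * lam + 3 * L)) :
    0 < 2 * lam * ‖x‖ ^ 2 - L * (‖x - s‖ * ‖x + s‖) - lam * ‖s‖ ^ 2 := by
  rw [lt_div_iff₀ (by linarith)] at h
  have hd := norm_nonneg (x - s)
  have hx : ‖s‖ - ‖x - s‖ ≤ ‖x‖ := by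
    have := norm_sub_norm_le s x
    rw [norm_sub_rev] at this
    linarith
  have hsum : ‖x + s‖ ≤ 2 * ‖s‖ + ‖x - s‖ := by
    calc ‖x + s‖ = ‖(x - s) + (s + s)‖ := by congr 1; abel
      _ ≤ ‖x - s‖ + (‖s‖ + ‖s‖) := (norm_add_le _ _).trans (by gcongr; exact norm_add_le _ _)
      _ = _ := by ring
  generalize ‖x - s‖ = d at *
  generalize ‖s‖ = r at *
  have hdr : d < r := by
    by_contra! hrd
    nlinarith
  have hsq : (r - d) ^ 2 ≤ ‖x‖ ^ 2 := pow_le_pow_left₀ (by linarith) hx 2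
  have h₁ : 2 * lam * (r - d) ^ 2 ≤ 2 * lam * ‖x‖ ^ 2 := by gcongr
  have h₂ : L * (d * ‖x + s‖) ≤ L * (d * (2 * r + d)) := by
    have : 0 ≤ L := by linarith
    gcongr
  have h₃ : r * (d * (4 * lam + 3 * L)) < r * (lam * r) := by
    gcongr
    linarith
  have h₄ : 0 ≤ L * d * (r - d) := mul_nonneg (mul_nonneg (by linarith) hd) (by linarith)
  nlinarith [mul_nonneg hlam.le (sq_nonneg d)]

/-- Under Assumption 1, with noisy measurements `bᵢ = ⟨x*, Aᵢ x*⟩ + εᵢ`,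
`x* ≠ 0`, and the noise bound `|(1/n) ∑ᵢ εᵢ ⟨v, Aᵢ v⟩| ≤ λ‖v‖²‖x*‖²` for every `v`,
every `x` with `min{‖x − x*‖, ‖x + x*‖} < λ‖x*‖/(4λ + 3λ̄)` has positive definite
Hessian `∇²f(x)`. -/
theorem stmt_19 {n p : ℕ} (hn : 0 < n) (hp : 0 < p)
    (A : Fin n → Matrix (Fin p) (Fin p) ℝ) (hA : ∀ i, (A i).IsSymm)
    (b ε : Fin n → ℝ) (lam lamBar : ℝ) (hlam : 0 < lam) (hlam' : lam ≤ lamBar)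
    (hAss : ∀ u v : EuclideanSpace ℝ (Fin p),
      lam * ‖u‖ ^ 2 * ‖v‖ ^ 2 ≤
          (1 / n : ℝ) * ∑ i, ⟪u, (Matrix.toEuclideanCLM (𝕜 := ℝ) (A i)) v⟫ ^ 2 ∧
        (1 / n : ℝ) * ∑ i, ⟪u, (Matrix.toEuclideanCLM (𝕜 := ℝ) (A i)) v⟫ ^ 2 ≤
          lamBar * ‖u‖ ^ 2 * ‖v‖ ^ 2)
    (xs : EuclideanSpace ℝ (Fin p)) (hxs : xs ≠ 0)
    (hb : ∀ i, b i = ⟪xs, (Matrix.toEuclideanCLM (𝕜 := ℝ) (A i)) xs⟫ + ε i)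
    (hnoise : ∀ v : EuclideanSpace ℝ (Fin p),
      |(1 / n : ℝ) * ∑ i, ε i * ⟪v, (Matrix.toEuclideanCLM (𝕜 := ℝ) (A i)) v⟫| ≤
        lam * ‖v‖ ^ 2 * ‖xs‖ ^ 2)
    (H : EuclideanSpace ℝ (Fin p) → Matrix (Fin p) (Fin p) ℝ)
    (hH : ∀ x, H x =
      (2 / n : ℝ) • ∑ i, A i * Matrix.vecMulVec (x : Fin p → ℝ) (x : Fin p → ℝ) * A i +
      (1 / n : ℝ) • ∑ i, (⟪x, (Matrix.toEuclideanCLM (𝕜 := ℝ) (A i)) x⟫ - b i) • A i) :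
    ∀ x : EuclideanSpace ℝ (Fin p),
      min ‖x - xs‖ ‖x + xs‖ < lam * ‖xs‖ / (4 * lam + 3 * lamBar) →
        ∀ v : EuclideanSpace ℝ (Fin p), v ≠ 0 →
          0 < ⟪v, (Matrix.toEuclideanCLM (𝕜 := ℝ) (H x)) v⟫ := by
  intro x hx v hv
  obtain ⟨s, hs, hsnorm, hsA⟩ : ∃ s : EuclideanSpace ℝ (Fin p),
      ‖x - s‖ < lam * ‖s‖ / (4 * lam + 3 * lamBar) ∧ ‖s‖ = ‖xs‖ ∧
      ∀ i, b i = ⟪s, (Matrix.toEuclideanCLM (𝕜 := ℝ) (A i)) s⟫ + ε i := by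
    rcases min_lt_iff.1 hx with h | h
    · exact ⟨xs, h, rfl, hb⟩
    · refine ⟨-xs, by simpa using h, norm_neg _, fun i => ?_⟩
      simpa using hb i
  have hc : 0 < ‖v‖ ^ 2 := by positivity
  have hcurv := mul_pos hc (curvature_pos hlam hlam' hs)
  have hquad := (hAss x v).1
  have hcross := neg_le_average_mul
    (fun i => ⟪x - s, Matrix.toEuclideanCLM (𝕜 := ℝ) (A i) (x + s)⟫)
    (fun i => ⟪v, Matrix.toEuclideanCLM (𝕜 := ℝ) (A i) v⟫)
    (α := ‖x - s‖ * ‖x + s‖) (β := ‖v‖ ^ 2) (L := lamBar)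
    (by positivity) hc.le (hlam.le.trans hlam')
    ((hAss (x - s) (x + s)).2.trans_eq (by ring)) ((hAss v v).2.trans_eq (by ring))
  have hε := (abs_le.1 (hnoise v)).2
  rw [← hsnorm] at hε
  rw [hH, hessian_quadratic_form hA]
  have hsplit : ∀ i, ⟪x, Matrix.toEuclideanCLM (𝕜 := ℝ) (A i) x⟫ - b i =
      ⟪x - s, Matrix.toEuclideanCLM (𝕜 := ℝ) (A i) (x + s)⟫ - ε i := fun i => by
    rw [hsA, ← inner_toEuclideanCLM_sub (hA i)]
    ring
  simp only [hsplit, sub_mul, Finset.sum_sub_distrib, mul_sub] at hcurv ⊢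
  linarith
end
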